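/- Let R = ℂ[x,y,z,w], let J = (x·z − y², x·w − y·z, y·w − z²) be the homogeneous ideal of the standard twisted cubic curve C ⊂ P³, let ℓ be a linear form and q a quadratic form such that ℓ, q is a regular sequence, let I = (ℓ, q) (the homogeneous ideal of a conic Q), and suppose that (x,y,z,w)^N ⊆ I + J for some natural number N (i.e., Q ∩ C = ∅). Then there exists a natural number M such that for all t ≥ M one has (I ∩ J) ∩ R_t = (I·J) ∩ R_t. (This expresses that the ideal sheaf of Y = Q ∪ C equals the product of the ideal sheaves of Q and C.) -/

import Mathlib

open MvPolynomial

attribute [local instance] MvPolynomial.gradedAlgebra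

namespace MvPolynomial

variable {σ R : Type*} [CommRing R]

/-- Removing the homogeneous components of degree less than `n` leaves an element of the `n`th
power of the irrelevant ideal. -/
theorem sub_sum_homogeneousComponent_mem_pow_idealOfVars (n : ℕ) (p : MvPolynomial σ R) :
    p - ∑ i ∈ Finset.range n, homogeneousComponent i p ∈ idealOfVars σ R ^ n := by
  rw [mem_pow_idealOfVars_iff']
  intro d hd
  simp [coeff_sum, coeff_homogeneousComponent, hd]

theorem totalDegree_sum_homogeneousComponent_le (n : ℕ) (p : MvPolynomial σ R) :
    (∑ i ∈ Finset.range n, homogeneousComponent i p).totalDegree ≤ n :=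
  totalDegree_finsetSum_le fun i hi =>
    (homogeneousComponent_isHomogeneous i p).totalDegree_le.trans (Finset.mem_range.mp hi).le

/-- If a power of the irrelevant ideal multiplies a finitely generated ideal `K` into a homogeneous
ideal `L`, then `L` contains all forms in `K` of sufficiently large degree. -/
theorem exists_forall_isHomogeneous_mem_of_pow_idealOfVars_mul_le {K L : Ideal (MvPolynomial σ R)}
    (hK : K.FG) (hL : L.IsHomogeneous (homogeneousSubmodule σ R)) {N : ℕ}
    (h : idealOfVars σ R ^ N * K ≤ L) :
    ∃ M : ℕ, ∀ t : ℕ, M ≤ t → ∀ f ∈ K, f.IsHomogeneous t → f ∈ L := by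
  obtain ⟨S, rfl⟩ := hK
  refine ⟨N + S.sup totalDegree + 1, fun t ht f hf hft => ?_⟩
  obtain ⟨c, -, rfl⟩ := Submodule.mem_span_finset.mp hf
  rw [← homogeneousComponent_eq_self hft, map_sum]
  refine sum_mem fun g hg => ?_
  set a := ∑ i ∈ Finset.range N, homogeneousComponent i (c g)
  have hlow : homogeneousComponent t (a * g) = 0 := by
    apply homogeneousComponent_eq_zero
    have h₁ : a.totalDegree ≤ N := totalDegree_sum_homogeneousComponent_le N (c g)
    have h₂ : g.totalDegree ≤ S.sup totalDegree := Finset.le_sup hg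
    have h₃ := totalDegree_mul a g
    omega
  have hhigh : (c g - a) * g ∈ L :=
    h (Ideal.mul_mem_mul (sub_sum_homogeneousComponent_mem_pow_idealOfVars N (c g))
      (Ideal.subset_span hg))
  have hsplit : c g • g = a * g + (c g - a) * g := by rw [smul_eq_mul]; ring
  rw [hsplit, map_add, hlow, zero_add]
  exact homogeneousComponent_mem_of_mem hL hhigh t

end MvPolynomial

/-- The product of the sum and the intersection of two ideals lies in their product. -/
theorem Ideal.sup_mul_inf_le_mul {A : Type*} [CommSemiring A] (I J : Ideal A) :
    (I ⊔ J) * (I ⊓ J) ≤ I * J := by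
  rw [Ideal.sup_mul]
  refine sup_le (Ideal.mul_mono_right inf_le_right) ?_
  rw [mul_comm I J]
  exact Ideal.mul_mono_right inf_le_left

/-- Variables: `x = X 0`, `y = X 1`, `z = X 2`, `w = X 3` in `R = ℂ[x,y,z,w]`.
If `C` is the standard twisted cubic, with ideal `J`, and `Q` is a conic, with ideal
`I = (ℓ, q)` (`ℓ, q` a regular sequence), disjoint from `C` (i.e. `(x,y,z,w)^N ⊆ I + J`
for some `N`), then `I ∩ J` and `I·J` agree in all sufficiently large degrees. -/
theorem ideal_of_disjoint_union_conic_twisted_cubic_eventually_product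
    (l q : MvPolynomial (Fin 4) ℂ)
    (hl : l.IsHomogeneous 1) (hq : q.IsHomogeneous 2)
    (hreg : RingTheory.Sequence.IsRegular (MvPolynomial (Fin 4) ℂ) [l, q])
    (J : Ideal (MvPolynomial (Fin 4) ℂ))
    (hJ : J = Ideal.span {X 0 * X 2 - X 1 ^ 2, X 0 * X 3 - X 1 * X 2, X 1 * X 3 - X 2 ^ 2})
    (I : Ideal (MvPolynomial (Fin 4) ℂ))
    (hI : I = Ideal.span {l, q})
    (hdisj : ∃ N : ℕ,
      (Ideal.span ({X 0, X 1, X 2, X 3} : Set (MvPolynomial (Fin 4) ℂ))) ^ N ≤ I + J) :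
    ∃ M : ℕ, ∀ t : ℕ, M ≤ t →
      Submodule.restrictScalars ℂ (I ⊓ J) ⊓ MvPolynomial.homogeneousSubmodule (Fin 4) ℂ t
        = Submodule.restrictScalars ℂ (I * J) ⊓
            MvPolynomial.homogeneousSubmodule (Fin 4) ℂ t := by
  obtain ⟨N, hN⟩ := hdisj
  have hvars : Ideal.span ({X 0, X 1, X 2, X 3} : Set (MvPolynomial (Fin 4) ℂ)) =
      idealOfVars (Fin 4) ℂ := by
    congr 1
    ext p
    simp [Fin.exists_fin_succ, eq_comm]
  have hIhom : I.IsHomogeneous (homogeneousSubmodule (Fin 4) ℂ) := by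
    rw [hI]
    refine Ideal.homogeneous_span _ _ ?_
    rintro p (rfl | rfl)
    exacts [⟨1, hl⟩, ⟨2, hq⟩]
  have hJhom : J.IsHomogeneous (homogeneousSubmodule (Fin 4) ℂ) := by
    rw [hJ]
    refine Ideal.homogeneous_span _ _ ?_
    have hX (i : Fin 4) : (X i : MvPolynomial (Fin 4) ℂ).IsHomogeneous 1 := isHomogeneous_X ℂ i
    rintro p (rfl | rfl | rfl)
    exacts [⟨2, ((hX 0).mul (hX 2)).sub ((hX 1).pow 2)⟩,
      ⟨2, ((hX 0).mul (hX 3)).sub ((hX 1).mul (hX 2))⟩,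
      ⟨2, ((hX 1).mul (hX 3)).sub ((hX 2).pow 2)⟩]
  have hmul : idealOfVars (Fin 4) ℂ ^ N * (I ⊓ J) ≤ I * J :=
    (Ideal.mul_mono_left (hvars ▸ hN)).trans (Ideal.sup_mul_inf_le_mul I J)
  obtain ⟨M, hM⟩ := exists_forall_isHomogeneous_mem_of_pow_idealOfVars_mul_le
    (IsNoetherian.noetherian (I ⊓ J)) (hIhom.mul hJhom) hmul
  refine ⟨M, fun t ht => le_antisymm ?_ ?_⟩
  · rintro f ⟨hf, hft⟩
    exact ⟨hM t ht f hf hft, hft⟩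
  · rintro f ⟨hf, hft⟩
    exact ⟨Ideal.mul_le_inf hf, hft⟩
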